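/- Suppose 0 ≤ α < 2. There exists a dense G_δ set G in C₁^α[0,1] (sup metric for 0 ≤ α < 1; C¹ metric on {f differentiable : |f'(x)−f'(y)| ≤ |x−y|^{α−1}} for 1 ≤ α < 2; C[0,1] when α = 0 and C¹[0,1] when α = 1) such that for every f ∈ G and every A ⊆ [0,1] on which f is convex or concave, the lower Minkowski dimension of A is at most max{0, α − 1}. -/

import Mathlib

open Set MeasureTheory

/-- The space `C₁^α[0,1]` (`0 ≤ α < 1`) of functions on `[0,1]` with
`|f x - f y| ≤ |x-y|^α` (all of `C[0,1]` when `α = 0`), with the sup metric. -/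
def HolderSet (α : ℝ) : Set C(Icc (0:ℝ) 1, ℝ) :=
  {f | α = 0 ∨ ∀ x y : Icc (0:ℝ) 1, |f x - f y| ≤ |(x : ℝ) - (y : ℝ)| ^ α}

/-- The space `C₁^{1+β}[0,1]`: pairs `(g, g')` where `g'` is the derivative of `g`
on `[0,1]` and `|g' x - g' y| ≤ |x-y|^β` (just `C¹[0,1]` when `β = 0`); the product
metric is exactly the `C¹` metric `max (‖g-h‖_∞) (‖g'-h'‖_∞)`. -/
def C1HolderSet (β : ℝ) : Set (C(Icc (0:ℝ) 1, ℝ) × C(Icc (0:ℝ) 1, ℝ)) :=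
  {p | (∀ x : Icc (0:ℝ) 1,
          HasDerivWithinAt (Set.IccExtend zero_le_one ⇑p.1) (p.2 x) (Icc 0 1) (x : ℝ)) ∧
       (β = 0 ∨ ∀ x y : Icc (0:ℝ) 1, |p.2 x - p.2 y| ≤ |(x : ℝ) - (y : ℝ)| ^ β)}

/-- `f` is convex on the set `A`: all second divided differences over triples of
points of `A` are nonnegative. -/
def ConvexOnSet (f : ℝ → ℝ) (A : Set ℝ) : Prop :=
  ∀ x₁ ∈ A, ∀ x₂ ∈ A, ∀ x₃ ∈ A, x₁ < x₂ → x₂ < x₃ →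
    0 ≤ ((f x₃ - f x₂) / (x₃ - x₂) - (f x₂ - f x₁) / (x₂ - x₁)) / (x₃ - x₁)

/-- `f` is concave on the set `A`. -/
def ConcaveOnSet (f : ℝ → ℝ) (A : Set ℝ) : Prop :=
  ∀ x₁ ∈ A, ∀ x₂ ∈ A, ∀ x₃ ∈ A, x₁ < x₂ → x₂ < x₃ →
    ((f x₃ - f x₂) / (x₃ - x₂) - (f x₂ - f x₁) / (x₂ - x₁)) / (x₃ - x₁) ≤ 0

/-- Number of dyadic grid intervals `[(j-1)/2^ℓ, j/2^ℓ]` meeting `A`. -/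
noncomputable def gridCount (ℓ : ℕ) (A : Set ℝ) : ℕ :=
  Set.ncard {j : ℤ | (A ∩ Icc (((j : ℝ) - 1) / 2 ^ ℓ) ((j : ℝ) / 2 ^ ℓ)).Nonempty}

/-- Lower Minkowski (box) dimension via dyadic grid counts. -/
noncomputable def lowerMinkowskiDim (A : Set ℝ) : ℝ :=
  Filter.liminf (fun ℓ : ℕ => Real.log (gridCount ℓ A) / (ℓ * Real.log 2)) Filter.atTop

/-- The second divided difference of `f` at three points, multiplied by the product of the
gaps between them. -/
def secondDiff (f : ℝ → ℝ) (x₁ x₂ x₃ : ℝ) : ℝ :=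
  (f x₃ - f x₂) * (x₂ - x₁) - (f x₂ - f x₁) * (x₃ - x₂)

theorem ConvexOnSet.secondDiff_nonneg {f : ℝ → ℝ} {A : Set ℝ} (h : ConvexOnSet f A)
    {x₁ x₂ x₃ : ℝ} (h₁ : x₁ ∈ A) (h₂ : x₂ ∈ A) (h₃ : x₃ ∈ A) (h₁₂ : x₁ < x₂) (h₂₃ : x₂ < x₃) :
    0 ≤ secondDiff f x₁ x₂ x₃ := by
  have h0 := h x₁ h₁ x₂ h₂ x₃ h₃ h₁₂ h₂₃
  have a : 0 < x₂ - x₁ := sub_pos.2 h₁₂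
  have b : 0 < x₃ - x₂ := sub_pos.2 h₂₃
  have c : 0 < x₃ - x₁ := by linarith
  have h1 := mul_nonneg h0 (mul_pos (mul_pos a b) c).le
  have : ((f x₃ - f x₂) / (x₃ - x₂) - (f x₂ - f x₁) / (x₂ - x₁)) / (x₃ - x₁) *
      ((x₂ - x₁) * (x₃ - x₂) * (x₃ - x₁)) = secondDiff f x₁ x₂ x₃ := by
    unfold secondDiff
    field_simp
  rwa [this] at h1

theorem ConcaveOnSet.neg {f : ℝ → ℝ} {A : Set ℝ} (h : ConcaveOnSet f A) :
    ConvexOnSet (-f) A := by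
  intro x₁ h₁ x₂ h₂ x₃ h₃ h₁₂ h₂₃
  have h0 := h x₁ h₁ x₂ h₂ x₃ h₃ h₁₂ h₂₃
  have : (((-f) x₃ - (-f) x₂) / (x₃ - x₂) - ((-f) x₂ - (-f) x₁) / (x₂ - x₁)) / (x₃ - x₁) =
      -(((f x₃ - f x₂) / (x₃ - x₂) - (f x₂ - f x₁) / (x₂ - x₁)) / (x₃ - x₁)) := by
    simp only [Pi.neg_apply]
    ring
  rw [this]
  linarith

/-- `[0,1]` splits into at most `m` pieces such that `f` is uniformly strongly concave along
triples of `r`-separated points of a common piece. -/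
def PiecewiseStronglyConcave (f : ℝ → ℝ) (m : ℕ) (r : ℝ) : Prop :=
  ∃ (piece : ℝ → ℤ × Bool) (s : Finset (ℤ × Bool)), s.card ≤ m ∧
    (∀ x ∈ Icc (0 : ℝ) 1, piece x ∈ s) ∧ ∃ c > 0,
      ∀ x₁ ∈ Icc (0 : ℝ) 1, ∀ x₂ ∈ Icc (0 : ℝ) 1, ∀ x₃ ∈ Icc (0 : ℝ) 1,
        piece x₁ = piece x₂ → piece x₂ = piece x₃ → r ≤ x₂ - x₁ → r ≤ x₃ - x₂ →
        secondDiff f x₁ x₂ x₃ ≤ -c * ((x₂ - x₁) * (x₃ - x₂) * (x₃ - x₁))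

theorem card_le_four_of_no_separated_triple (S : Finset ℤ)
    (h : ∀ a ∈ S, ∀ b ∈ S, ∀ c ∈ S, a + 2 ≤ b → ¬ b + 2 ≤ c) : S.card ≤ 4 := by
  rcases S.eq_empty_or_nonempty with rfl | hS
  · simp
  set a := S.min' hS with ha
  have haS : a ∈ S := S.min'_mem hS
  have hmin : ∀ j ∈ S, a ≤ j := fun j hj => S.min'_le j hj
  rcases (S.filter (fun j => a + 2 ≤ j)).eq_empty_or_nonempty with hB | hB
  · have : S ⊆ {a, a + 1} := by
      intro j hj
      have h1 := hmin j hj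
      have h2 : ¬ a + 2 ≤ j := Finset.filter_eq_empty_iff.1 hB hj
      simp only [Finset.mem_insert, Finset.mem_singleton]
      omega
    exact (Finset.card_le_card this).trans (Finset.card_le_two.trans (by norm_num))
  · set b := (S.filter (fun j => a + 2 ≤ j)).min' hB with hb
    have hbS := (S.filter (fun j => a + 2 ≤ j)).min'_mem hB
    rw [← hb, Finset.mem_filter] at hbS
    have : S ⊆ {a, a + 1, b, b + 1} := by
      intro j hj
      have h1 := hmin j hj
      have h2 : a + 2 ≤ j → b ≤ j := fun h' => Finset.min'_le _ _ (Finset.mem_filter.2 ⟨hj, h'⟩)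
      have h3 := h a haS b hbS.1 j hj hbS.2
      simp only [Finset.mem_insert, Finset.mem_singleton]
      omega
    exact (Finset.card_le_card this).trans Finset.card_le_four

theorem finite_grid {A : Set ℝ} (hA : A ⊆ Icc 0 1) (ℓ : ℕ) :
    {j : ℤ | (A ∩ Icc (((j : ℝ) - 1) / 2 ^ ℓ) ((j : ℝ) / 2 ^ ℓ)).Nonempty}.Finite := by
  refine (Set.finite_Icc (0 : ℤ) (2 ^ ℓ + 1)).subset ?_
  rintro j ⟨x, hx, h1, h2⟩
  have h2l : (0 : ℝ) < 2 ^ ℓ := by positivity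
  obtain ⟨h3, h4⟩ := hA hx
  rw [div_le_iff₀ h2l] at h1
  rw [le_div_iff₀ h2l] at h2
  constructor
  · have : (0 : ℝ) ≤ j := by nlinarith
    exact_mod_cast this
  · have : (j : ℝ) ≤ 2 ^ ℓ + 1 := by nlinarith
    exact_mod_cast this

theorem gridCount_le_of_pieces {ι : Type*} {A : Set ℝ} (hA : A ⊆ Icc 0 1) (ℓ : ℕ)
    (piece : ℝ → ι) (s : Finset ι) (hs : ∀ x ∈ A, piece x ∈ s)
    (hsep : ∀ x₁ ∈ A, ∀ x₂ ∈ A, ∀ x₃ ∈ A, piece x₁ = piece x₂ → piece x₂ = piece x₃ →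
      1 / 2 ^ ℓ ≤ x₂ - x₁ → ¬ 1 / 2 ^ ℓ ≤ x₃ - x₂) :
    gridCount ℓ A ≤ 4 * s.card := by
  classical
  have hfin : ∀ i, {j : ℤ | ({x ∈ A | piece x = i} ∩
      Icc (((j : ℝ) - 1) / 2 ^ ℓ) ((j : ℝ) / 2 ^ ℓ)).Nonempty}.Finite := fun i =>
    finite_grid (fun x hx => hA hx.1) ℓ
  have hsub : {j : ℤ | (A ∩ Icc (((j : ℝ) - 1) / 2 ^ ℓ) ((j : ℝ) / 2 ^ ℓ)).Nonempty} ⊆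
      (s.biUnion fun i => (hfin i).toFinset : Finset ℤ) := by
    rintro j ⟨x, hx, hj⟩
    simp only [Finset.coe_biUnion, Set.mem_iUnion, Finite.coe_toFinset]
    exact ⟨piece x, hs x hx, x, ⟨hx, rfl⟩, hj⟩
  have hgap : ∀ j k : ℤ, j + 2 ≤ k → ∀ x y : ℝ, x ≤ (j : ℝ) / 2 ^ ℓ → ((k : ℝ) - 1) / 2 ^ ℓ ≤ y →
      1 / 2 ^ ℓ ≤ y - x := by
    intro j k hjk x y hx hy
    have hjk' : (j : ℝ) + 2 ≤ k := by exact_mod_cast hjk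
    have : ((j : ℝ) + 1) / 2 ^ ℓ ≤ ((k : ℝ) - 1) / 2 ^ ℓ := by
      gcongr
      linarith
    rw [add_div] at this
    linarith
  unfold gridCount
  refine (Set.ncard_le_ncard hsub (Finset.finite_toSet _)).trans ?_
  rw [Set.ncard_coe_finset, mul_comm]
  refine Finset.card_biUnion_le_card_mul _ _ _ fun i _ => card_le_four_of_no_separated_triple _ ?_
  intro a ha b hb c hc hab hbc
  simp only [Finite.mem_toFinset] at ha hb hc
  obtain ⟨x, ⟨hx, hxi⟩, hxa⟩ := ha
  obtain ⟨y, ⟨hy, hyi⟩, hyb⟩ := hb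
  obtain ⟨z, ⟨hz, hzi⟩, hzc⟩ := hc
  exact hsep x hx y hy z hz (hxi.trans hyi.symm) (hyi.trans hzi.symm)
    (hgap a b hab x y hxa.2 hyb.1) (hgap b c hbc y z hyb.2 hzc.1)

theorem PiecewiseStronglyConcave.exists_gridCount_le {f : ℝ → ℝ} {m ℓ : ℕ}
    (hf : PiecewiseStronglyConcave f m (1 / 2 ^ ℓ)) :
    ∃ δ > 0, ∀ g : ℝ → ℝ, (∀ x ∈ Icc (0 : ℝ) 1, |g x - f x| ≤ δ) →
      ∀ A ⊆ Icc (0 : ℝ) 1, ConvexOnSet g A → gridCount ℓ A ≤ 4 * m := by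
  obtain ⟨piece, s, hsm, hs, c, hc, h⟩ := hf
  set r : ℝ := 1 / 2 ^ ℓ with hr
  have hr0 : 0 < r := by positivity
  refine ⟨c * r ^ 2 / 4, by positivity, fun g hg A hA hconv => ?_⟩
  refine (gridCount_le_of_pieces hA ℓ piece s (fun x hx => hs x (hA hx)) ?_).trans (by omega)
  intro x₁ h₁ x₂ h₂ x₃ h₃ e₁ e₂ g₁ g₂
  rw [← hr] at g₁ g₂
  have hD := h x₁ (hA h₁) x₂ (hA h₂) x₃ (hA h₃) e₁ e₂ g₁ g₂
  have hG := hconv.secondDiff_nonneg h₁ h₂ h₃ (by linarith) (by linarith)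
  have k₁ := abs_le.1 (hg x₁ (hA h₁))
  have k₂ := abs_le.1 (hg x₂ (hA h₂))
  have k₃ := abs_le.1 (hg x₃ (hA h₃))
  set δ := c * r ^ 2 / 4 with hδ
  have hdiff : secondDiff g x₁ x₂ x₃ - secondDiff f x₁ x₂ x₃ ≤ 2 * δ * (x₃ - x₁) := by
    have e : secondDiff g x₁ x₂ x₃ - secondDiff f x₁ x₂ x₃ =
        ((g x₃ - f x₃) - (g x₂ - f x₂)) * (x₂ - x₁) +
        ((g x₁ - f x₁) - (g x₂ - f x₂)) * (x₃ - x₂) := by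
      unfold secondDiff; ring
    have u₁ : ((g x₃ - f x₃) - (g x₂ - f x₂)) * (x₂ - x₁) ≤ 2 * δ * (x₂ - x₁) :=
      mul_le_mul_of_nonneg_right (by linarith) (by linarith)
    have u₂ : ((g x₁ - f x₁) - (g x₂ - f x₂)) * (x₃ - x₂) ≤ 2 * δ * (x₃ - x₂) :=
      mul_le_mul_of_nonneg_right (by linarith) (by linarith)
    rw [e]
    linarith
  have hprod : r ^ 2 ≤ (x₂ - x₁) * (x₃ - x₂) := by nlinarith
  have h3 : 0 < x₃ - x₁ := by linarith
  have h4 : c * r ^ 2 * (x₃ - x₁) ≤ c * ((x₂ - x₁) * (x₃ - x₂)) * (x₃ - x₁) := by gcongr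
  have h5 : 0 < c * r ^ 2 * (x₃ - x₁) := by positivity
  nlinarith

theorem lowerMinkowskiDim_le {A : Set ℝ} {b : ℝ}
    (h : ∀ n : ℕ, ∃ ℓ : ℕ, n < ℓ ∧ (gridCount ℓ A : ℝ) ≤ 2 ^ (ℓ * (b + 1 / (n + 1 : ℝ))))
    (hb : 0 ≤ b) : lowerMinkowskiDim A ≤ b := by
  have h2 : 0 < Real.log 2 := Real.log_pos (by norm_num)
  refine le_of_forall_pos_le_add fun ε hε => ?_
  refine Filter.liminf_le_of_frequently_le ?_
    (Filter.isBoundedUnder_of ⟨0, fun ℓ => ?_⟩)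
  · rw [Filter.frequently_atTop]
    intro k
    obtain ⟨n₀, hn₀⟩ := exists_nat_one_div_lt hε
    obtain ⟨ℓ, hℓ, hg⟩ := h (max k n₀)
    refine ⟨ℓ, by omega, ?_⟩
    have hℓ0 : (0 : ℝ) < ℓ := by exact_mod_cast (by omega : 0 < ℓ)
    have hε' : 1 / ((max k n₀ : ℕ) + 1 : ℝ) ≤ ε := by
      refine le_trans ?_ hn₀.le
      have : (n₀ : ℝ) ≤ (max k n₀ : ℕ) := by exact_mod_cast le_max_right _ _
      gcongr
    rw [div_le_iff₀ (by positivity)]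
    rcases Nat.eq_zero_or_pos (gridCount ℓ A) with h0 | h0
    · rw [h0]
      simp only [Nat.cast_zero, Real.log_zero]
      positivity
    · have := Real.log_le_log (by exact_mod_cast h0) hg
      rw [Real.log_rpow (by norm_num)] at this
      refine this.trans ?_
      have : (ℓ : ℝ) * (b + 1 / ((max k n₀ : ℕ) + 1 : ℝ)) * Real.log 2 ≤
        (ℓ : ℝ) * (b + ε) * Real.log 2 := by gcongr
      linarith
  · have : 0 ≤ Real.log (gridCount ℓ A) := Real.log_natCast_nonneg _
    simp only [ge_iff_le]
    positivity

theorem exists_dense_isGδ_lowerMinkowskiDim_le {X : Type*} [MetricSpace X] [BaireSpace X]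
    (E : X → ℝ → ℝ) (hE : ∀ f g x, |E f x - E g x| ≤ dist f g)
    (neg : X → X) (hneg : Isometry neg) (hnn : Function.Involutive neg)
    (hEneg : ∀ f, E (neg f) = -E f) {b : ℝ} (hb : 0 ≤ b)
    (happrox : ∀ f : X, ∀ ε > 0, ∀ η > 0, ∀ n : ℕ, ∃ g, dist g f < ε ∧ ∃ ℓ m : ℕ, n < ℓ ∧
      (4 * m : ℝ) ≤ 2 ^ (ℓ * (b + η)) ∧ PiecewiseStronglyConcave (E g) m (1 / 2 ^ ℓ)) :
    ∃ G : Set X, Dense G ∧ IsGδ G ∧ ∀ f ∈ G, ∀ A ⊆ Icc (0 : ℝ) 1,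
      (ConvexOnSet (E f) A ∨ ConcaveOnSet (E f) A) → lowerMinkowskiDim A ≤ b := by
  set U : ℕ → Set X := fun n => interior {f | ∃ ℓ : ℕ, n < ℓ ∧ ∀ A ⊆ Icc (0 : ℝ) 1,
    ConvexOnSet (E f) A → (gridCount ℓ A : ℝ) ≤ 2 ^ (ℓ * (b + 1 / (n + 1 : ℝ)))} with hU
  have hUo : ∀ n, IsOpen (U n) := fun n => isOpen_interior
  have hUd : ∀ n, Dense (U n) := by
    intro n
    rw [Metric.dense_iff]
    intro f ε hε
    obtain ⟨g, hgf, ℓ, m, hℓ, hm, hg⟩ := happrox f ε hε (1 / (n + 1 : ℝ)) (by positivity) n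
    obtain ⟨δ, hδ, h⟩ := hg.exists_gridCount_le
    refine ⟨g, hgf, mem_interior.2 ⟨Metric.ball g δ, ?_, Metric.isOpen_ball,
      Metric.mem_ball_self hδ⟩⟩
    intro k hk
    refine ⟨ℓ, hℓ, fun A hA hc => ?_⟩
    have h1 := h (E k) (fun x _ => (hE k g x).trans (Metric.mem_ball.1 hk).le) A hA hc
    refine le_trans ?_ hm
    exact_mod_cast h1
  have hVd : ∀ n, Dense (neg ⁻¹' U n) := by
    intro n
    rw [Metric.dense_iff]
    intro f ε hε
    obtain ⟨g, hg, hgU⟩ := Metric.dense_iff.1 (hUd n) (neg f) ε hε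
    refine ⟨neg g, ?_, by rwa [Set.mem_preimage, hnn g]⟩
    rw [Metric.mem_ball] at hg ⊢
    rw [← hneg.dist_eq, hnn g]
    exact hg
  have hVo : ∀ n, IsOpen (neg ⁻¹' U n) := fun n => (hUo n).preimage hneg.continuous
  refine ⟨⋂ n, (U n ∩ neg ⁻¹' U n), ?_, ?_, ?_⟩
  · exact dense_iInter_of_isOpen (fun n => (hUo n).inter (hVo n))
      fun n => (hUd n).inter_of_isOpen_left (hVd n) (hUo n)
  · exact IsGδ.iInter fun n => ((hUo n).inter (hVo n)).isGδ
  · intro f hf A hA hc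
    rw [Set.mem_iInter] at hf
    refine lowerMinkowskiDim_le (fun n => ?_) hb
    rcases hc with hc | hc
    · obtain ⟨ℓ, hℓ, h⟩ := interior_subset (hf n).1
      exact ⟨ℓ, hℓ, h A hA hc⟩
    · obtain ⟨ℓ, hℓ, h⟩ := interior_subset (hf n).2
      exact ⟨ℓ, hℓ, h A hA (by rw [hEneg]; exact hc.neg)⟩

theorem PiecewiseStronglyConcave.congr {f g : ℝ → ℝ} {m : ℕ} {r : ℝ}
    (hf : PiecewiseStronglyConcave f m r) (h : ∀ x ∈ Icc (0 : ℝ) 1, f x = g x) :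
    PiecewiseStronglyConcave g m r := by
  obtain ⟨piece, s, hsm, hs, c, hc, hD⟩ := hf
  refine ⟨piece, s, hsm, hs, c, hc, fun x₁ h₁ x₂ h₂ x₃ h₃ e₁ e₂ g₁ g₂ => ?_⟩
  have := hD x₁ h₁ x₂ h₂ x₃ h₃ e₁ e₂ g₁ g₂
  rwa [secondDiff, h x₁ h₁, h x₂ h₂, h x₃ h₃] at this

/-- Infimal convolution of `f` with the kernel `φ`. -/
noncomputable def infConv (φ f : ℝ → ℝ) (x : ℝ) : ℝ := ⨅ t, f (x + t) + φ t

section InfConv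

variable {φ f : ℝ → ℝ} {M : ℝ}

theorem infConv_le (hφ : ∀ t, 0 ≤ φ t) (hf : ∀ x, |f x| ≤ M) (x z : ℝ) :
    infConv φ f x ≤ f z + φ (z - x) := by
  have hb : BddBelow (Set.range fun t => f (x + t) + φ t) := by
    refine ⟨-M, ?_⟩
    rintro _ ⟨t, rfl⟩
    have := (abs_le.1 (hf (x + t))).1
    have := hφ t
    dsimp only
    linarith
  have := ciInf_le hb (z - x)
  simpa [infConv] using this

theorem le_infConv {x c : ℝ} (h : ∀ z, c ≤ f z + φ (z - x)) : c ≤ infConv φ f x :=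
  le_ciInf fun t => by simpa using h (x + t)

theorem abs_infConv_le (hφ : ∀ t, 0 ≤ φ t) (hφ0 : φ 0 = 0) (hf : ∀ x, |f x| ≤ M) (x : ℝ) :
    |infConv φ f x| ≤ M := by
  rw [abs_le]
  constructor
  · refine le_infConv fun z => ?_
    have := (abs_le.1 (hf z)).1
    have := hφ (z - x)
    linarith
  · have := infConv_le hφ hf x x
    rw [sub_self, hφ0] at this
    linarith [(abs_le.1 (hf x)).2]

theorem abs_infConv_sub_le (hφ : ∀ t, 0 ≤ φ t) (hf : ∀ x, |f x| ≤ M) {x y B : ℝ}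
    (h : ∀ t, |f (x + t) - f (y + t)| ≤ B) : |infConv φ f x - infConv φ f y| ≤ B := by
  have key : ∀ x y : ℝ, (∀ t, |f (x + t) - f (y + t)| ≤ B) →
      infConv φ f x - B ≤ infConv φ f y := by
    intro x y h
    refine le_infConv fun z => ?_
    have h1 := infConv_le hφ hf x (x + (z - y))
    have h2 := (abs_le.1 (h (z - y))).2
    rw [add_sub_cancel_left] at h1
    rw [show y + (z - y) = z by ring] at h2
    linarith
  have h1 := key x y h
  have h2 := key y x fun t => by rw [abs_sub_comm]; exact h t
  rw [abs_le]
  constructor <;> linarith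

theorem continuous_infConv (hφ : ∀ t, 0 ≤ φ t) (hf : ∀ x, |f x| ≤ M) (hc : UniformContinuous f) :
    Continuous (infConv φ f) := by
  refine UniformContinuous.continuous (Metric.uniformContinuous_iff.2 fun ε hε => ?_)
  obtain ⟨δ, hδ, h⟩ := Metric.uniformContinuous_iff.1 hc (ε / 2) (by positivity)
  refine ⟨δ, hδ, fun x y hxy => ?_⟩
  refine lt_of_le_of_lt (abs_infConv_sub_le (B := ε / 2) hφ hf fun t => ?_) (by linarith)
  exact (h (by simpa [Real.dist_eq] using hxy)).le

theorem exists_abs_infConv_sub_le {ψ : ℝ → ℝ} (hψ : ∀ t, 0 ≤ ψ t) (hψ0 : ψ 0 = 0)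
    (hψ1 : ∀ δ > 0, ∃ κ > 0, ∀ t, δ ≤ |t| → κ ≤ ψ t)
    (hf : ∀ x, |f x| ≤ M) (hc : UniformContinuous f) {ε : ℝ} (hε : 0 < ε) :
    ∃ S : ℝ, 0 ≤ S ∧ ∀ x, |infConv (fun t => S * ψ t) f x - f x| ≤ ε := by
  obtain ⟨δ, hδ, h⟩ := Metric.uniformContinuous_iff.1 hc ε hε
  obtain ⟨κ, hκ, hκψ⟩ := hψ1 δ hδ
  have hM : 0 ≤ M := (abs_nonneg _).trans (hf 0)
  have hS : 0 ≤ 2 * M / κ := by positivity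
  refine ⟨2 * M / κ, hS, fun x => ?_⟩
  have hφ : ∀ t, 0 ≤ 2 * M / κ * ψ t := fun t => mul_nonneg hS (hψ t)
  rw [abs_le]
  constructor
  · have : f x - ε ≤ infConv (fun t => 2 * M / κ * ψ t) f x := by
      refine le_infConv fun z => ?_
      rcases lt_or_ge |z - x| δ with hz | hz
      · have h1 := (abs_le.1 (h (a := z) (b := x) hz).le).1
        have := hφ (z - x)
        linarith
      · have h1 : 2 * M / κ * κ ≤ 2 * M / κ * ψ (z - x) := by
          gcongr
          exact hκψ _ hz
        rw [div_mul_cancel₀ _ hκ.ne'] at h1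
        have := (abs_le.1 (hf z)).1
        have := (abs_le.1 (hf x)).2
        linarith
    linarith
  · have := infConv_le (φ := fun t => 2 * M / κ * ψ t) hφ hf x x
    simp only [sub_self, hψ0, mul_zero] at this
    linarith

theorem infConv_sq_secondDiff_le {S : ℝ} (hS : 0 ≤ S) (hf : ∀ x, |f x| ≤ M) {x₁ x₂ x₃ : ℝ}
    (h₁₂ : x₁ < x₂) (h₂₃ : x₂ < x₃) :
    secondDiff (infConv (fun t => S * t ^ 2) f) x₁ x₂ x₃ ≤
      S * ((x₂ - x₁) * (x₃ - x₂) * (x₃ - x₁)) := by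
  set v := infConv (fun t => S * t ^ 2) f with hv
  have hφ : ∀ t, 0 ≤ S * t ^ 2 := fun t => by positivity
  have hpos : 0 < x₃ - x₁ := by linarith
  have : (v x₃ * (x₂ - x₁) + v x₁ * (x₃ - x₂) -
      S * ((x₂ - x₁) * (x₃ - x₂) * (x₃ - x₁))) / (x₃ - x₁) ≤ v x₂ := by
    refine le_infConv fun z => ?_
    rw [div_le_iff₀ hpos]
    have h1 := mul_le_mul_of_nonneg_right (infConv_le hφ hf x₁ z) (sub_pos.2 h₂₃).le
    have h3 := mul_le_mul_of_nonneg_right (infConv_le hφ hf x₃ z) (sub_pos.2 h₁₂).le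
    rw [← hv] at h1 h3
    have e : (f z + S * (z - x₂) ^ 2) * (x₃ - x₁) = (f z + S * (z - x₃) ^ 2) * (x₂ - x₁) +
      (f z + S * (z - x₁) ^ 2) * (x₃ - x₂) - S * ((x₂ - x₁) * (x₃ - x₂) * (x₃ - x₁)) := by ring
    rw [e]
    linarith
  rw [div_le_iff₀ hpos] at this
  unfold secondDiff
  linarith

theorem infConv_abs_sub_le {S : ℝ} (hS : 0 ≤ S) (hf : ∀ x, |f x| ≤ M) (x y : ℝ) :
    infConv (fun t => S * |t|) f y - infConv (fun t => S * |t|) f x ≤ S * |y - x| := by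
  have hφ : ∀ t, 0 ≤ S * |t| := fun t => by positivity
  have : infConv (fun t => S * |t|) f y - S * |y - x| ≤ infConv (fun t => S * |t|) f x := by
    refine le_infConv fun z => ?_
    have h1 := infConv_le hφ hf y z
    have h2 : S * |z - y| ≤ S * (|z - x| + |y - x|) := by
      gcongr
      rw [abs_sub_comm y x]
      exact abs_sub_le z x y
    linarith
  linarith

end InfConv

theorem abs_comp_fract_sub_le {T : ℝ → ℝ} {L : ℝ} (h0 : ∀ t ∈ Ico (0 : ℝ) 1, 0 ≤ T t)
    (h1 : ∀ t ∈ Ico (0 : ℝ) 1, T t ≤ L * t) (h2 : ∀ t ∈ Ico (0 : ℝ) 1, T t ≤ L * (1 - t))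
    (hT : ∀ s ∈ Ico (0 : ℝ) 1, ∀ t ∈ Ico (0 : ℝ) 1, |T s - T t| ≤ L * |s - t|) (x y : ℝ) :
    |T (Int.fract x) - T (Int.fract y)| ≤ L * |x - y| := by
  have hm : ∀ x : ℝ, Int.fract x ∈ Ico (0 : ℝ) 1 := fun x => ⟨Int.fract_nonneg x, Int.fract_lt_one x⟩
  have hL : 0 ≤ L := by
    have := (h0 (1 / 2) (by norm_num)).trans (h1 (1 / 2) (by norm_num))
    linarith
  wlog hxy : x ≤ y generalizing x y
  · rw [abs_sub_comm, abs_sub_comm x]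
    exact this y x (not_le.1 hxy).le
  rcases eq_or_lt_of_le (Int.floor_mono hxy) with he | hlt
  · refine (hT _ (hm x) _ (hm y)).trans (le_of_eq ?_)
    congr 2
    simp only [Int.fract, he]
    ring
  · have hlt' : (⌊x⌋ : ℝ) + 1 ≤ ⌊y⌋ := by exact_mod_cast hlt
    have ex := Int.self_sub_floor x
    have ey := Int.self_sub_floor y
    have a1 := Int.fract_lt_one x
    have a2 := Int.fract_nonneg y
    rw [abs_sub_comm x, abs_of_nonneg (sub_nonneg.2 hxy), abs_le]
    constructor
    · have := (h1 _ (hm y)).trans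
        (mul_le_mul_of_nonneg_left (by linarith : Int.fract y ≤ y - x) hL)
      linarith [h0 _ (hm x)]
    · have := (h2 _ (hm x)).trans
        (mul_le_mul_of_nonneg_left (by linarith : 1 - Int.fract x ≤ y - x) hL)
      linarith [h0 _ (hm y)]

theorem floor_mul_mem_Icc {x : ℝ} (hx : x ∈ Icc (0 : ℝ) 1) (N : ℕ) :
    ⌊N * x⌋ ∈ Finset.Icc (0 : ℤ) N := by
  rw [Finset.mem_Icc]
  have hN : (0 : ℝ) ≤ N := Nat.cast_nonneg N
  refine ⟨Int.floor_nonneg.2 (mul_nonneg hN hx.1), ?_⟩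
  have : (⌊N * x⌋ : ℝ) ≤ (N : ℝ) := (Int.floor_le _).trans (by nlinarith [hx.2])
  exact_mod_cast this

theorem continuous_of_abs_sub_le {q : ℝ → ℝ} {L : ℝ} (h : ∀ x y, |q x - q y| ≤ L * |x - y|) :
    Continuous q := by
  refine (LipschitzWith.of_dist_le_mul (K := L.toNNReal) fun x y => ?_).continuous
  rw [Real.dist_eq, Real.dist_eq]
  exact (h x y).trans (mul_le_mul_of_nonneg_right (Real.le_coe_toNNReal L) (abs_nonneg _))

theorem exists_small {M ε : ℝ} (hM : 0 ≤ M) (hε : 0 < ε) :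
    ∃ ρ > 0, ρ < 1 ∧ ρ * (M + 2) ≤ ε := by
  refine ⟨min (1 / 2) (ε / (M + 2)), by positivity, ?_, ?_⟩
  · exact lt_of_le_of_lt (min_le_left _ _) (by norm_num)
  · exact (mul_le_mul_of_nonneg_right (min_le_right _ _) (by positivity)).trans
      (div_mul_cancel₀ _ (by positivity)).le

theorem abs_contract_add_sub_le {M ρ a v q : ℝ} (hρ : 0 ≤ ρ) (hv : |v| ≤ M) (hva : |v - a| ≤ ρ)
    (hq : |q| ≤ ρ) : |(1 - ρ) * v + q - a| ≤ ρ * (M + 2) := by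
  have h1 : |ρ * v| ≤ ρ * M := by rw [abs_mul, abs_of_nonneg hρ]; gcongr
  rw [abs_le] at *
  constructor <;> nlinarith

theorem abs_contract_add_sub_contract_add_le {ρ v w q r B : ℝ} (hρ : ρ ≤ 1)
    (hv : |v - w| ≤ B) (hq : |q - r| ≤ ρ * B) :
    |(1 - ρ) * v + q - ((1 - ρ) * w + r)| ≤ B := by
  have h1 : |(1 - ρ) * (v - w)| ≤ (1 - ρ) * B := by
    rw [abs_mul, abs_of_nonneg (sub_nonneg.2 hρ)]
    exact mul_le_mul_of_nonneg_left hv (sub_nonneg.2 hρ)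
  have h2 := abs_add_le ((1 - ρ) * (v - w)) (q - r)
  rw [show (1 - ρ) * v + q - ((1 - ρ) * w + r) = (1 - ρ) * (v - w) + (q - r) by ring]
  linarith

/-- A bounded uniformly continuous function is uniformly approximated, without loss in its
Hölder constant, by functions that are strongly concave on finitely many pieces. -/
theorem exists_piecewiseStronglyConcave_approx {f : ℝ → ℝ} {M : ℝ} (hf : ∀ x, |f x| ≤ M)
    (hc : UniformContinuous f) {ε : ℝ} (hε : 0 < ε) :
    ∃ (g : ℝ → ℝ) (m : ℕ), Continuous g ∧ (∀ x, |g x - f x| ≤ ε) ∧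
      (∀ α : ℝ, α ≤ 1 → ∀ x y, x ≠ y → |x - y| ≤ 1 →
        (∀ t, |f (x + t) - f (y + t)| ≤ |x - y| ^ α) → |g x - g y| ≤ |x - y| ^ α) ∧
      ∀ r > 0, PiecewiseStronglyConcave g m r := by
  have hM : 0 ≤ M := (abs_nonneg _).trans (hf 0)
  obtain ⟨ρ, hρ, hρ1, hρε⟩ := exists_small hM hε
  obtain ⟨S, hS, hv⟩ := exists_abs_infConv_sub_le (ψ := fun t => t ^ 2) (fun t => sq_nonneg t)
    (by simp) (fun δ hδ => ⟨δ ^ 2, by positivity, fun t ht => by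
      rw [← sq_abs t]; gcongr⟩) hf hc hρ
  have hφ : ∀ t, 0 ≤ S * t ^ 2 := fun t => by positivity
  have hvM := abs_infConv_le hφ (by simp) hf
  have hvc := continuous_infConv hφ hf hc
  have hvB := fun x y B => abs_infConv_sub_le (x := x) (y := y) (B := B) hφ hf
  have hvD := fun x₁ x₂ x₃ => infConv_sq_secondDiff_le (x₁ := x₁) (x₂ := x₂) (x₃ := x₃) hS hf
  set v := infConv (fun t => S * t ^ 2) f
  set K := S + 1 with hK
  have hK0 : 0 < K := by positivity
  obtain ⟨N, hN⟩ := exists_nat_ge (K / ρ)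
  have hN0 : (0 : ℝ) < N := lt_of_lt_of_le (by positivity) hN
  have hN1 : (1 : ℝ) ≤ N := by exact_mod_cast Nat.one_le_iff_ne_zero.2 (by rintro rfl; simp at hN0)
  have hKN : K / N ≤ ρ := by
    rw [div_le_iff₀ hρ] at hN
    rw [div_le_iff₀ hN0]
    linarith
  set T : ℝ → ℝ := fun t => t * (1 - t) with hT
  set q : ℝ → ℝ := fun x => K / N ^ 2 * T (Int.fract (N * x)) with hq
  have hqL : ∀ x y, |q x - q y| ≤ ρ * |x - y| := by
    intro x y
    have h1 : |T (Int.fract (N * x)) - T (Int.fract (N * y))| ≤ 1 * |N * x - N * y| := by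
      refine abs_comp_fract_sub_le ?_ ?_ ?_ ?_ _ _
      · rintro t ⟨h, h'⟩
        exact mul_nonneg h (by linarith)
      · rintro t ⟨h, h'⟩
        simp only [hT]
        nlinarith
      · rintro t ⟨h, h'⟩
        simp only [hT]
        nlinarith
      · rintro s ⟨h, h'⟩ t ⟨k, k'⟩
        rw [show T s - T t = (1 - s - t) * (s - t) by simp only [hT]; ring, abs_mul]
        gcongr
        rw [abs_le]
        constructor <;> linarith
    rw [one_mul, ← mul_sub, abs_mul, abs_of_pos hN0] at h1
    simp only [hq]
    rw [← mul_sub, abs_mul, abs_of_pos (by positivity : 0 < K / N ^ 2)]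
    calc _ ≤ K / N ^ 2 * (N * |x - y|) := by gcongr
      _ = K / N * |x - y| := by field_simp
      _ ≤ ρ * |x - y| := by gcongr
  have hqρ : ∀ x, |q x| ≤ ρ := by
    intro x
    have a1 := Int.fract_lt_one (N * x)
    have a2 := Int.fract_nonneg (N * x)
    have a3 : 0 ≤ T (Int.fract (N * x)) := mul_nonneg a2 (by linarith)
    have a4 : T (Int.fract (N * x)) ≤ 1 := by simp only [hT]; nlinarith
    rw [abs_of_nonneg (mul_nonneg (by positivity) a3)]
    calc _ ≤ K / N ^ 2 * 1 := by gcongr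
      _ ≤ K / N := by
        rw [mul_one]
        gcongr
        nlinarith
      _ ≤ ρ := hKN
  refine ⟨fun x => (1 - ρ) * v x + q x, N + 1, ?_, ?_, ?_, ?_⟩
  · exact (hvc.const_mul _).add (continuous_of_abs_sub_le hqL)
  · exact fun x => (abs_contract_add_sub_le hρ.le (hvM x) (hv x) (hqρ x)).trans hρε
  · intro α hα x y hne hxy h
    refine abs_contract_add_sub_contract_add_le hρ1.le (hvB x y _ h) ((hqL x y).trans ?_)
    gcongr
    have : |x - y| ^ (1 : ℝ) ≤ |x - y| ^ α :=
      Real.rpow_le_rpow_of_exponent_ge (abs_pos.2 (sub_ne_zero.2 hne)) hxy hα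
    rwa [Real.rpow_one] at this
  · intro r hr
    refine ⟨fun x => (⌊N * x⌋, true), Finset.Icc (0 : ℤ) N ×ˢ {true}, by simp, ?_, 1, one_pos, ?_⟩
    · intro x hx
      simpa using floor_mul_mem_Icc hx N
    · intro x₁ _ x₂ _ x₃ _ e₁ e₂ g₁ g₂
      simp only [Prod.mk.injEq, and_true] at e₁ e₂
      have d := hvD x₁ x₂ x₃ (by linarith) (by linarith)
      have hp : 0 ≤ (x₂ - x₁) * (x₃ - x₂) * (x₃ - x₁) :=
        mul_nonneg (mul_nonneg (by linarith) (by linarith)) (by linarith)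
      have dq : secondDiff q x₁ x₂ x₃ = -K * ((x₂ - x₁) * (x₃ - x₂) * (x₃ - x₁)) := by
        simp only [secondDiff, hq, hT, Int.fract, e₁, e₂]
        field_simp
        ring
      have e : secondDiff (fun x => (1 - ρ) * v x + q x) x₁ x₂ x₃ =
          (1 - ρ) * secondDiff v x₁ x₂ x₃ + secondDiff q x₁ x₂ x₃ := by
        simp only [secondDiff]; ring
      rw [e, dq, hK]
      have d1 := mul_le_mul_of_nonneg_left d (by linarith : 0 ≤ 1 - ρ)
      have d2 : 0 ≤ ρ * (S * ((x₂ - x₁) * (x₃ - x₂) * (x₃ - x₁))) := by positivity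
      linarith

theorem secondDiff_le_of_deriv {F g : ℝ → ℝ} {x₁ x₂ x₃ : ℝ} (h₁₂ : x₁ < x₂) (h₂₃ : x₂ < x₃)
    (hF : ∀ x ∈ Icc x₁ x₃, HasDerivWithinAt F (g x) (Icc x₁ x₃) x)
    (hg : ∀ x ∈ Icc x₁ x₃, ∀ y ∈ Icc x₁ x₃, x ≤ y → g y - g x ≤ -(y - x)) :
    secondDiff F x₁ x₂ x₃ ≤ -(1 / 2) * ((x₂ - x₁) * (x₃ - x₂) * (x₃ - x₁)) := by
  set h : ℝ → ℝ := fun x => F x + x ^ 2 / 2 with hh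
  have hd : ∀ x ∈ Icc x₁ x₃, HasDerivWithinAt h (g x + x) (Icc x₁ x₃) x := by
    intro x hx
    have := (hF x hx).add (((hasDerivWithinAt_id x (Icc x₁ x₃)).pow 2).div_const 2)
    refine this.congr_deriv ?_
    simp
  have hcont : ContinuousOn h (Icc x₁ x₃) := fun x hx => (hd x hx).continuousWithinAt
  have hda : ∀ x ∈ Ioo x₁ x₃, HasDerivAt h (g x + x) x := fun x hx =>
    (hd x (Ioo_subset_Icc_self hx)).hasDerivAt (Icc_mem_nhds hx.1 hx.2)
  obtain ⟨a, ha, ea⟩ := exists_hasDerivAt_eq_slope h (fun x => g x + x) h₁₂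
    (hcont.mono (Icc_subset_Icc_right h₂₃.le)) fun x hx => hda x ⟨hx.1, hx.2.trans h₂₃⟩
  obtain ⟨b, hb, eb⟩ := exists_hasDerivAt_eq_slope h (fun x => g x + x) h₂₃
    (hcont.mono (Icc_subset_Icc_left h₁₂.le)) fun x hx => hda x ⟨h₁₂.trans hx.1, hx.2⟩
  have hab := hg a ⟨ha.1.le, (ha.2.trans h₂₃).le⟩ b ⟨(h₁₂.trans hb.1).le, hb.2.le⟩
    (ha.2.trans hb.1).le
  rw [eq_div_iff (by linarith)] at ea eb
  have e : secondDiff h x₁ x₂ x₃ = ((g b + b) - (g a + a)) * ((x₂ - x₁) * (x₃ - x₂)) := by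
    unfold secondDiff
    rw [← ea, ← eb]
    ring
  have e' : secondDiff h x₁ x₂ x₃ = secondDiff F x₁ x₂ x₃ +
      1 / 2 * ((x₂ - x₁) * (x₃ - x₂) * (x₃ - x₁)) := by
    simp only [secondDiff, hh]
    ring
  have : ((g b + b) - (g a + a)) * ((x₂ - x₁) * (x₃ - x₂)) ≤ 0 :=
    mul_nonpos_of_nonpos_of_nonneg (by linarith)
      (mul_nonneg (by linarith) (by linarith))
  linarith

open Filter Topology in
theorem exists_scale {β η C : ℝ} (hβ : β < 1) (hη : 0 < η) (n : ℕ) :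
    ∃ ℓ : ℕ, n < ℓ ∧ C ≤ 2 ^ (ℓ * η) ∧ C * 2 ^ (ℓ * β) ≤ (2 : ℝ) ^ ℓ := by
  have key : ∀ γ : ℝ, 0 < γ → ∀ᶠ ℓ : ℕ in atTop, C ≤ (2 : ℝ) ^ (ℓ * γ) := by
    intro γ hγ
    have h1 : Tendsto (fun ℓ : ℕ => ((2 : ℝ) ^ γ) ^ ℓ) atTop atTop :=
      tendsto_pow_atTop_atTop_of_one_lt (Real.one_lt_rpow (by norm_num) hγ)
    filter_upwards [h1.eventually_ge_atTop C] with ℓ h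
    rwa [mul_comm, Real.rpow_mul_natCast (by norm_num)]
  obtain ⟨ℓ, h1, h2, h3⟩ := ((key η hη).and ((key (1 - β) (by linarith)).and
    (eventually_gt_atTop n))).exists
  refine ⟨ℓ, h3, h1, ?_⟩
  calc C * 2 ^ (ℓ * β) ≤ (2 : ℝ) ^ (ℓ * (1 - β)) * 2 ^ (ℓ * β) := by gcongr
    _ = 2 ^ ℓ := by
      rw [← Real.rpow_add (by norm_num), ← mul_add]
      simp

/-- A bounded uniformly continuous function is uniformly approximated, without loss in its
`β`-Hölder constant, by functions whose antiderivatives are strongly concave on few pieces. -/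
theorem exists_piecewiseStronglyConcave_deriv_approx {f : ℝ → ℝ} {M : ℝ} (hf : ∀ x, |f x| ≤ M)
    (hc : UniformContinuous f) {β : ℝ} (hβ0 : 0 ≤ β) (hβ1 : β < 1) {ε η : ℝ} (hε : 0 < ε)
    (hη : 0 < η) (n : ℕ) :
    ∃ (g : ℝ → ℝ) (ℓ m : ℕ), Continuous g ∧ (∀ x, |g x - f x| ≤ ε) ∧
      (∀ x y, (∀ t, |f (x + t) - f (y + t)| ≤ |x - y| ^ β) → |g x - g y| ≤ |x - y| ^ β) ∧
      n < ℓ ∧ (4 * m : ℝ) ≤ 2 ^ (ℓ * (β + η)) ∧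
      ∀ F : ℝ → ℝ, (∀ x ∈ Icc (0 : ℝ) 1, HasDerivWithinAt F (g x) (Icc 0 1) x) →
        PiecewiseStronglyConcave F m (1 / 2 ^ ℓ) := by
  have hM : 0 ≤ M := (abs_nonneg _).trans (hf 0)
  obtain ⟨ρ, hρ, hρ1, hρε⟩ := exists_small hM hε
  obtain ⟨S, hS, hv⟩ := exists_abs_infConv_sub_le (ψ := fun t => |t|) (fun t => abs_nonneg t)
    (by simp) (fun δ hδ => ⟨δ, hδ, fun t ht => ht⟩) hf hc hρ
  have hφ : ∀ t, 0 ≤ S * |t| := fun t => by positivity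
  have hvM := abs_infConv_le hφ (by simp) hf
  have hvc := continuous_infConv hφ hf hc
  have hvB := fun x y B => abs_infConv_sub_le (x := x) (y := y) (B := B) hφ hf
  have hvS := infConv_abs_sub_le hS hf
  set v := infConv (fun t => S * |t|) f
  set K := S + 1 with hK
  have hK0 : 0 < K := by positivity
  obtain ⟨ℓ, hnℓ, hℓη, hℓβ⟩ := exists_scale (C := 8 * (K / ρ + 2)) hβ1 hη n
  set P : ℝ := 2 ^ (ℓ * β) with hP
  have hP1 : 1 ≤ P := Real.one_le_rpow (by norm_num) (by positivity)
  have hR : (0 : ℝ) < 2 ^ ℓ := by positivity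
  set N := ⌈K / ρ * P⌉₊ with hN
  have hN1 : K / ρ * P ≤ N := Nat.le_ceil _
  have hN2 : (N : ℝ) ≤ K / ρ * P + 1 := (Nat.ceil_lt_add_one (by positivity)).le
  have hN0 : (0 : ℝ) < N := lt_of_lt_of_le (by positivity) hN1
  have hKN : K / N * P ≤ ρ := by
    rw [div_mul_eq_mul_div, div_le_iff₀ hρ] at hN1
    rw [div_mul_eq_mul_div, div_le_iff₀ hN0]
    linarith
  have hKN' : K / N ≤ ρ := (le_mul_of_one_le_right (by positivity) hP1).trans hKN
  set θ : ℝ := N / 2 ^ ℓ with hθ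
  have hθ0 : 0 < θ := by positivity
  have hKρ : 0 < K / ρ := by positivity
  have hθ1 : θ ≤ 1 := by
    rw [hθ, div_le_one hR]
    nlinarith
  have hθi : 1 ≤ 1 / θ := by rwa [le_div_iff₀ hθ0, one_mul]
  set T : ℝ → ℝ := fun t => min (1 - t) (t / θ) with hT
  set q : ℝ → ℝ := fun x => K / N * T (Int.fract (N * x)) with hq
  have hT0 : ∀ t ∈ Ico (0 : ℝ) 1, 0 ≤ T t := fun t ht =>
    le_min (by linarith [ht.2]) (div_nonneg ht.1 hθ0.le)
  have hT1 : ∀ t ∈ Ico (0 : ℝ) 1, T t ≤ 1 := fun t ht =>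
    (min_le_left _ _).trans (by linarith [ht.1])
  have hm : ∀ x : ℝ, Int.fract (N * x) ∈ Ico (0 : ℝ) 1 := fun x =>
    ⟨Int.fract_nonneg _, Int.fract_lt_one _⟩
  have hTL : ∀ x y : ℝ, |T (Int.fract (N * x)) - T (Int.fract (N * y))| ≤ 2 ^ ℓ * |x - y| := by
    intro x y
    have h1 : |T (Int.fract (N * x)) - T (Int.fract (N * y))| ≤ 1 / θ * |N * x - N * y| := by
      refine abs_comp_fract_sub_le hT0 ?_ ?_ ?_ _ _
      · intro t _
        exact (min_le_right _ _).trans (le_of_eq (by ring))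
      · intro t ht
        exact (min_le_left _ _).trans (le_mul_of_one_le_left (by linarith [ht.2]) hθi)
      · intro s _ t _
        refine (abs_min_sub_min_le_max _ _ _ _).trans (max_le ?_ ?_)
        · rw [show 1 - s - (1 - t) = -(s - t) by ring, abs_neg]
          exact le_mul_of_one_le_left (abs_nonneg _) hθi
        · rw [← sub_div, abs_div, abs_of_pos hθ0, div_eq_mul_one_div, mul_comm]
    rw [← mul_sub, abs_mul, abs_of_pos hN0] at h1
    refine h1.trans (le_of_eq ?_)
    rw [hθ]
    field_simp
  have hqsub : ∀ x y, |q x - q y| = K / N * |T (Int.fract (N * x)) - T (Int.fract (N * y))| := by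
    intro x y
    simp only [hq]
    rw [← mul_sub, abs_mul, abs_of_pos (by positivity : 0 < K / N)]
  have hqρ : ∀ x, |q x| ≤ ρ := by
    intro x
    rw [abs_of_nonneg (mul_nonneg (by positivity) (hT0 _ (hm x)))]
    exact (mul_le_of_le_one_right (by positivity) (hT1 _ (hm x))).trans hKN'
  refine ⟨fun x => (1 - ρ) * v x + q x, ℓ, 2 * (N + 1), ?_, ?_, ?_, hnℓ, ?_, ?_⟩
  · refine (hvc.const_mul _).add (continuous_of_abs_sub_le (L := K / N * 2 ^ ℓ) fun x y => ?_)
    rw [hqsub, mul_assoc]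
    gcongr
    exact hTL x y
  · exact fun x => (abs_contract_add_sub_le hρ.le (hvM x) (hv x) (hqρ x)).trans hρε
  · intro x y h
    refine abs_contract_add_sub_contract_add_le hρ1.le (hvB x y _ h) ?_
    have h1 : |T (Int.fract (N * x)) - T (Int.fract (N * y))| ≤ 1 := by
      have := hT0 _ (hm x)
      have := hT0 _ (hm y)
      have := hT1 _ (hm x)
      have := hT1 _ (hm y)
      rw [abs_le]
      constructor <;> linarith
    have h2 : |T (Int.fract (N * x)) - T (Int.fract (N * y))| ≤ (2 ^ ℓ * |x - y|) ^ β := by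
      rcases le_total 1 (2 ^ ℓ * |x - y|) with h' | h'
      · exact h1.trans (Real.one_le_rpow h' hβ0)
      · refine (hTL x y).trans ?_
        exact Real.self_le_rpow_of_le_one (by positivity) h' hβ1.le
    rw [Real.mul_rpow hR.le (abs_nonneg _), ← Real.rpow_natCast, ← Real.rpow_mul (by norm_num)]
      at h2
    rw [hqsub]
    calc _ ≤ K / N * (P * |x - y| ^ β) := by gcongr
      _ = K / N * P * |x - y| ^ β := by ring
      _ ≤ ρ * |x - y| ^ β := by gcongr
  · rw [mul_add (ℓ : ℝ), Real.rpow_add (by norm_num), ← hP]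
    push_cast
    calc (4 * (2 * (N + 1)) : ℝ) ≤ P * (8 * (K / ρ + 2)) := by nlinarith
      _ ≤ P * 2 ^ (ℓ * η) := by gcongr
  · intro F hF
    refine ⟨fun x => (⌊N * x⌋, decide (Int.fract (N * x) < θ)), Finset.Icc (0 : ℤ) N ×ˢ Finset.univ,
      ?_, ?_, 1 / 2, by norm_num, ?_⟩
    · simp [mul_comm]
    · intro x hx
      exact Finset.mem_product.2 ⟨floor_mul_mem_Icc hx N, Finset.mem_univ _⟩
    · intro x₁ k₁ x₂ _ x₃ k₃ e₁ e₂ g₁ g₂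
      simp only [Prod.mk.injEq, decide_eq_decide] at e₁ e₂
      have hr : (0 : ℝ) < 1 / 2 ^ ℓ := by positivity
      have hsub : Icc x₁ x₃ ⊆ Icc 0 1 := Icc_subset_Icc k₁.1 k₃.2
      by_cases hlt : Int.fract (N * x₁) < θ
      · have hlt2 := e₁.2.1 hlt
        have f₁ := Int.fract_nonneg (N * x₁)
        have e₁' : (⌊N * x₁⌋ : ℝ) = ⌊N * x₂⌋ := by exact_mod_cast e₁.1
        rw [Int.fract] at hlt2 f₁
        have : N * (1 / 2 ^ ℓ) ≤ N * (x₂ - x₁) := by gcongr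
        rw [mul_one_div, ← hθ] at this
        linarith
      · refine secondDiff_le_of_deriv (by linarith) (by linarith)
          (fun x hx => (hF x (hsub hx)).mono hsub) ?_
        have hin : ∀ x ∈ Icc x₁ x₃, q x = K / N * (1 - (N * x - ⌊N * x₁⌋)) := by
          intro x hx
          have m₁ : ⌊N * x₁⌋ ≤ ⌊N * x⌋ := Int.floor_mono (mul_le_mul_of_nonneg_left hx.1 hN0.le)
          have m₂ : ⌊N * x⌋ ≤ ⌊N * x₃⌋ := Int.floor_mono (mul_le_mul_of_nonneg_left hx.2 hN0.le)
          have m₃ : ⌊N * x⌋ = ⌊N * x₁⌋ := by omega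
          have m₄ : θ ≤ Int.fract (N * x) := by
            refine (not_lt.1 hlt).trans ?_
            rw [Int.fract, Int.fract, m₃]
            gcongr
            exact hx.1
          have m₅ : T (Int.fract (N * x)) = 1 - Int.fract (N * x) := by
            refine min_eq_left ?_
            have : 1 ≤ Int.fract (N * x) / θ := by rwa [le_div_iff₀ hθ0, one_mul]
            linarith [Int.fract_nonneg (N * x)]
          simp only [hq]
          rw [m₅, Int.fract, m₃]
        intro x hx y hy hxy
        have hs := hvS x y
        rw [abs_of_nonneg (sub_nonneg.2 hxy)] at hs
        rw [hin x hx, hin y hy]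
        have e : K / N * (1 - (N * y - ⌊N * x₁⌋)) - K / N * (1 - (N * x - ⌊N * x₁⌋)) =
            -K * (y - x) := by field_simp; ring
        have d1 := mul_le_mul_of_nonneg_left hs (by linarith : 0 ≤ 1 - ρ)
        have d2 : 0 ≤ ρ * (S * (y - x)) :=
          mul_nonneg hρ.le (mul_nonneg hS (sub_nonneg.2 hxy))
        rw [hK] at e
        linarith

section Extension

theorem uniformContinuous_IccExtend (u : C(Icc (0 : ℝ) 1, ℝ)) :
    UniformContinuous (IccExtend zero_le_one ⇑u) :=
  (CompactSpace.uniformContinuous_of_continuous u.continuous).comp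
    (LipschitzWith.projIcc zero_le_one).uniformContinuous

theorem abs_IccExtend_le (u : C(Icc (0 : ℝ) 1, ℝ)) (x : ℝ) :
    |IccExtend zero_le_one ⇑u x| ≤ ‖u‖ :=
  u.norm_coe_le_norm _

theorem abs_IccExtend_sub_le_dist (u v : C(Icc (0 : ℝ) 1, ℝ)) (x : ℝ) :
    |IccExtend zero_le_one ⇑u x - IccExtend zero_le_one ⇑v x| ≤ dist u v :=
  ContinuousMap.dist_apply_le_dist (f := u) (g := v) _

theorem IccExtend_neg (u : C(Icc (0 : ℝ) 1, ℝ)) :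
    IccExtend zero_le_one ⇑(-u) = -IccExtend zero_le_one ⇑u := rfl

theorem abs_IccExtend_add_sub_le {u : C(Icc (0 : ℝ) 1, ℝ)} {β : ℝ} (hβ : 0 ≤ β)
    (h : ∀ x y : Icc (0 : ℝ) 1, |u x - u y| ≤ |(x : ℝ) - y| ^ β) (x y t : ℝ) :
    |IccExtend zero_le_one ⇑u (x + t) - IccExtend zero_le_one ⇑u (y + t)| ≤ |x - y| ^ β := by
  refine (h _ _).trans (Real.rpow_le_rpow (abs_nonneg _) ?_ hβ)
  have := (LipschitzWith.projIcc (zero_le_one' ℝ)).dist_le_mul (x + t) (y + t)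
  simpa [Subtype.dist_eq, Real.dist_eq] using this

end Extension

theorem isClosed_holderSet (α : ℝ) : IsClosed (HolderSet α) := by
  by_cases h : α = 0
  · have : HolderSet α = Set.univ := Set.eq_univ_of_forall fun f => Or.inl h
    rw [this]
    exact isClosed_univ
  · have : HolderSet α = ⋂ x : Icc (0 : ℝ) 1, ⋂ y : Icc (0 : ℝ) 1,
        {f | |f x - f y| ≤ |(x : ℝ) - (y : ℝ)| ^ α} := by
      ext f
      simp only [HolderSet, h, false_or, Set.mem_ofPred_eq, Set.mem_iInter]
    rw [this]
    exact isClosed_iInter fun x => isClosed_iInter fun y => isClosed_le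
      ((continuous_eval_const x).sub (continuous_eval_const y)).abs continuous_const

theorem hasDerivWithinAt_integral {g : ℝ → ℝ} (hg : Continuous g) (c : ℝ) (s : Set ℝ) (x : ℝ) :
    HasDerivWithinAt (fun x => c + ∫ t in (0 : ℝ)..x, g t) (g x) s x := by
  have := (hg.integral_hasStrictDerivAt 0 x).hasDerivAt.hasDerivWithinAt (s := s)
  exact this.const_add c

theorem hasDerivWithinAt_IccExtend_iff (u v : C(Icc (0 : ℝ) 1, ℝ)) :
    (∀ x : Icc (0 : ℝ) 1, HasDerivWithinAt (IccExtend zero_le_one ⇑u) (v x) (Icc 0 1) (x : ℝ)) ↔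
      ∀ x : Icc (0 : ℝ) 1,
        u x = u ⟨0, by simp⟩ + ∫ t in (0 : ℝ)..x, IccExtend zero_le_one ⇑v t := by
  have hv : Continuous (IccExtend zero_le_one ⇑v) := (uniformContinuous_IccExtend v).continuous
  have hv' : ∀ x : Icc (0 : ℝ) 1, IccExtend zero_le_one ⇑v x = v x := fun x => by simp
  constructor
  · intro h x
    have h1 : ∫ t in (0 : ℝ)..x, IccExtend zero_le_one ⇑v t =
        IccExtend zero_le_one ⇑u x - IccExtend zero_le_one ⇑u 0 := by
      refine intervalIntegral.integral_eq_sub_of_hasDerivAt_of_le x.2.1 ?_ ?_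
        (hv.intervalIntegrable _ _)
      · exact (uniformContinuous_IccExtend u).continuous.continuousOn
      · intro y hy
        have hy1 : y < 1 := hy.2.trans_le x.2.2
        have := h ⟨y, hy.1.le, hy1.le⟩
        rw [← hv'] at this
        exact this.hasDerivAt (Icc_mem_nhds hy.1 hy1)
    rw [h1, IccExtend_of_mem _ _ x.2, IccExtend_of_mem _ _ (by simp : (0 : ℝ) ∈ Icc (0 : ℝ) 1)]
    simp
  · intro h x
    have := hasDerivWithinAt_integral hv (u ⟨0, by simp⟩) (Icc 0 1) x
    rw [hv'] at this
    refine this.congr_of_mem (fun y hy => ?_) x.2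
    rw [IccExtend_of_mem _ _ hy, h ⟨y, hy⟩]

theorem isClosed_c1HolderSet (β : ℝ) : IsClosed (C1HolderSet β) := by
  have hd : IsClosed {p : C(Icc (0 : ℝ) 1, ℝ) × C(Icc (0 : ℝ) 1, ℝ) | ∀ x : Icc (0 : ℝ) 1,
      HasDerivWithinAt (IccExtend zero_le_one ⇑p.1) (p.2 x) (Icc 0 1) (x : ℝ)} := by
    simp only [hasDerivWithinAt_IccExtend_iff, Set.ofPred_forall]
    refine isClosed_iInter fun x => isClosed_eq ((continuous_eval_const x).comp continuous_fst)
      (((continuous_eval_const _).comp continuous_fst).add ?_)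
    refine intervalIntegral.continuous_parametric_intervalIntegral_of_continuous' ?_ _ _
    have : Continuous fun z : (C(Icc (0 : ℝ) 1, ℝ) × C(Icc (0 : ℝ) 1, ℝ)) × ℝ =>
        z.1.2 (projIcc 0 1 zero_le_one z.2) :=
      (continuous_snd.comp continuous_fst).eval (continuous_projIcc.comp continuous_snd)
    exact this
  exact hd.inter ((isClosed_holderSet β).preimage continuous_snd)

theorem holder_generic {α : ℝ} (hα0 : 0 ≤ α) (hα1 : α < 1) :
    ∃ G : Set (HolderSet α), Dense G ∧ IsGδ G ∧
      ∀ f ∈ G, ∀ A ⊆ Icc (0:ℝ) 1,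
        (ConvexOnSet (Set.IccExtend zero_le_one ⇑f.1) A ∨
         ConcaveOnSet (Set.IccExtend zero_le_one ⇑f.1) A) →
        lowerMinkowskiDim A ≤ 0 := by
  have : CompleteSpace (HolderSet α) := (isClosed_holderSet α).completeSpace_coe
  refine exists_dense_isGδ_lowerMinkowskiDim_le (fun f : HolderSet α => IccExtend zero_le_one ⇑f.1)
    (fun f g x => abs_IccExtend_sub_le_dist _ _ x)
    (fun f => ⟨-f.1, f.2.imp id fun h x y => by
      simpa [abs_sub_comm, neg_add_eq_sub] using h y x⟩)
    (Isometry.of_dist_eq fun f g => dist_neg_neg f.1 g.1) (fun f => Subtype.ext (neg_neg f.1))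
    (fun f => IccExtend_neg f.1) le_rfl ?_
  intro f ε hε η hη n
  obtain ⟨g, m, hgc, hgf, hgα, hg⟩ := exists_piecewiseStronglyConcave_approx
    (abs_IccExtend_le f.1) (uniformContinuous_IccExtend f.1) (half_pos hε)
  obtain ⟨ℓ, hnℓ, hℓ, -⟩ := exists_scale (C := 4 * m) zero_lt_one hη n
  refine ⟨⟨⟨fun x => g x, hgc.comp continuous_subtype_val⟩, ?_⟩, ?_, ℓ, m, hnℓ, by simpa using hℓ, ?_⟩
  · refine f.2.imp id fun h x y => ?_
    rcases eq_or_ne x y with rfl | hxy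
    · simp only [sub_self, abs_zero]
      exact Real.rpow_nonneg le_rfl _
    · refine hgα α hα1.le x y (fun h => hxy (Subtype.ext h)) ?_
        (abs_IccExtend_add_sub_le hα0 h _ _)
      rw [abs_le]
      constructor <;> linarith [x.2.1, x.2.2, y.2.1, y.2.2]
  · refine lt_of_le_of_lt ?_ (half_lt_self hε)
    refine (ContinuousMap.dist_le (half_pos hε).le).2 fun x => ?_
    simpa [Real.dist_eq] using hgf x
  · exact (hg _ (by positivity)).congr fun x hx => by
      rw [IccExtend_of_mem _ _ hx]
      rfl

theorem c1Holder_generic {β : ℝ} (hβ0 : 0 ≤ β) (hβ1 : β < 1) :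
    ∃ G : Set (C1HolderSet β), Dense G ∧ IsGδ G ∧
      ∀ f ∈ G, ∀ A ⊆ Icc (0:ℝ) 1,
        (ConvexOnSet (Set.IccExtend zero_le_one ⇑f.1.1) A ∨
         ConcaveOnSet (Set.IccExtend zero_le_one ⇑f.1.1) A) →
        lowerMinkowskiDim A ≤ β := by
  have : CompleteSpace (C1HolderSet β) := (isClosed_c1HolderSet β).completeSpace_coe
  refine exists_dense_isGδ_lowerMinkowskiDim_le
    (fun f : C1HolderSet β => IccExtend zero_le_one ⇑f.1.1)
    (fun f g x => (abs_IccExtend_sub_le_dist _ _ x).trans (le_max_left _ _))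
    (fun f => ⟨-f.1, fun x => (f.2.1 x).neg, f.2.2.imp id fun h x y => by
      simpa [abs_sub_comm, neg_add_eq_sub] using h y x⟩)
    (Isometry.of_dist_eq fun f g => ?_) (fun f => Subtype.ext (neg_neg f.1))
    (fun f => IccExtend_neg f.1.1) hβ0 ?_
  · exact congrArg₂ max (dist_neg_neg f.1.1 g.1.1) (dist_neg_neg f.1.2 g.1.2)
  intro f ε hε η hη n
  obtain ⟨g, ℓ, m, hgc, hgf, hgβ, hnℓ, hm, hg⟩ := exists_piecewiseStronglyConcave_deriv_approx
    (abs_IccExtend_le f.1.2) (uniformContinuous_IccExtend f.1.2) hβ0 hβ1 (half_pos hε) hη n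
  set F : ℝ → ℝ := fun x => f.1.1 ⟨0, by simp⟩ + ∫ t in (0 : ℝ)..x, g t with hF
  have hFd : ∀ x, HasDerivWithinAt F (g x) (Icc 0 1) x :=
    hasDerivWithinAt_integral hgc _ _
  have hFc : Continuous F :=
    continuous_const.add (intervalIntegral.continuous_primitive (fun a b => hgc.intervalIntegrable a b) 0)
  set u : C(Icc (0 : ℝ) 1, ℝ) := ⟨fun x => F x, hFc.comp continuous_subtype_val⟩ with hu
  set v : C(Icc (0 : ℝ) 1, ℝ) := ⟨fun x => g x, hgc.comp continuous_subtype_val⟩ with hv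
  have huF : ∀ x ∈ Icc (0 : ℝ) 1, IccExtend zero_le_one ⇑u x = F x :=
    fun x hx => IccExtend_of_mem _ _ hx
  have hud : ∀ x ∈ Icc (0 : ℝ) 1,
      HasDerivWithinAt (IccExtend zero_le_one ⇑u) (g x) (Icc 0 1) x :=
    fun x hx => (hFd x).congr_of_mem huF hx
  refine ⟨⟨(u, v), fun x => hud x x.2, f.2.2.imp id fun h x y => ?_⟩, ?_, ℓ, m, hnℓ, hm, hg _ hud⟩
  · exact hgβ x y (abs_IccExtend_add_sub_le hβ0 h _ _)
  · refine lt_of_le_of_lt (max_le ?_ ?_) (half_lt_self hε)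
    · refine (ContinuousMap.dist_le (half_pos hε).le).2 fun x => ?_
      have hd : ∀ y ∈ Icc (0 : ℝ) 1, HasDerivWithinAt (F - IccExtend zero_le_one ⇑f.1.1)
          (g y - IccExtend zero_le_one ⇑f.1.2 y) (Icc 0 1) y := by
        intro y hy
        rw [IccExtend_of_mem _ _ hy]
        exact (hFd y).sub (f.2.1 ⟨y, hy⟩)
      have hmv := (convex_Icc (0 : ℝ) 1).norm_image_sub_le_of_norm_hasDerivWithin_le hd
        (fun y _ => hgf y) (by simp : (0 : ℝ) ∈ Icc (0 : ℝ) 1) x.2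
      have h0 : (F - IccExtend zero_le_one ⇑f.1.1) 0 = 0 := by
        rw [Pi.sub_apply, IccExtend_of_mem _ _ (by simp : (0 : ℝ) ∈ Icc (0 : ℝ) 1)]
        simp [hF]
      rw [h0, sub_zero, sub_zero, Real.norm_eq_abs, Real.norm_eq_abs, abs_of_nonneg x.2.1,
        Pi.sub_apply, IccExtend_of_mem _ _ x.2] at hmv
      rw [Real.dist_eq]
      exact hmv.trans (mul_le_of_le_one_right (half_pos hε).le x.2.2)
    · refine (ContinuousMap.dist_le (half_pos hε).le).2 fun x => ?_
      rw [Real.dist_eq]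
      simpa [hv] using hgf x
theorem generic_convex_restriction_small (α : ℝ) (hα0 : 0 ≤ α) (hα2 : α < 2) :
    (α < 1 → ∃ G : Set (HolderSet α), Dense G ∧ IsGδ G ∧
      ∀ f ∈ G, ∀ A ⊆ Icc (0:ℝ) 1,
        (ConvexOnSet (Set.IccExtend zero_le_one ⇑f.1) A ∨
         ConcaveOnSet (Set.IccExtend zero_le_one ⇑f.1) A) →
        lowerMinkowskiDim A ≤ max 0 (α - 1)) ∧
    (1 ≤ α → ∃ G : Set (C1HolderSet (α - 1)), Dense G ∧ IsGδ G ∧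
      ∀ f ∈ G, ∀ A ⊆ Icc (0:ℝ) 1,
        (ConvexOnSet (Set.IccExtend zero_le_one ⇑f.1.1) A ∨
         ConcaveOnSet (Set.IccExtend zero_le_one ⇑f.1.1) A) →
        lowerMinkowskiDim A ≤ max 0 (α - 1)) := by
  refine ⟨fun h => ?_, fun h => ?_⟩
  · rw [max_eq_left (by linarith)]
    exact holder_generic hα0 h
  · rw [max_eq_right (by linarith)]
    exact c1Holder_generic (by linarith) (by linarith)
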